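/- Let p ∈ (−n, 1), ε ∈ (0, 1/3), and let μ be a Borel measure on S^{n-1} with dμ = f dH^{n-1} where τ_1 < f < τ_2 for constants τ_2 > τ_1 > 0. Then for every convex body K in ℝ^n there exists a unique ξ(K) ∈ int K such that Φ_ε(K, ξ(K)) = max_{ξ ∈ int K} Φ_ε(K, ξ). -/

import Mathlib

open MeasureTheory Metric Set Filter
open scoped ENNReal RealInnerProductSpace NNReal

noncomputable section

abbrev Eu (n : ℕ) : Type := EuclideanSpace ℝ (Fin n)

def IsConvexBody {n : ℕ} (K : Set (Eu n)) : Prop :=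
  Convex ℝ K ∧ IsCompact K ∧ (interior K).Nonempty

def suppFn {n : ℕ} (K : Set (Eu n)) (u : Eu n) : ℝ :=
  sSup ((fun x => ⟪x, u⟫) '' K)

def IsOuterNormal {n : ℕ} (K : Set (Eu n)) (x u : Eu n) : Prop :=
  ‖u‖ = 1 ∧ ∀ y ∈ K, ⟪y, u⟫ ≤ ⟪x, u⟫

def gaussMap {n : ℕ} (K : Set (Eu n)) (x : Eu n) : Eu n :=
  open scoped Classical in
  if h : ∃ u, IsOuterNormal K x u then h.choose else 0

def lpSurf {n : ℕ} (p : ℝ) (K : Set (Eu n)) (ω : Set (Eu n)) : ℝ≥0∞ :=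
  ∫⁻ x in {x ∈ frontier K | gaussMap K x ∈ ω},
    ENNReal.ofReal (⟪x, gaussMap K x⟫ ^ (1 - p)) ∂(μH[(n:ℝ) - 1])


/-- The function `φ` of Section 3: `φ(t) = t^p` for `p ∈ (0,1)`, `log t` for `p = 0`, and
`-t^p` for `p ∈ (-n,0)`. -/
def phiFn (p : ℝ) (t : ℝ) : ℝ :=
  if 0 < p then t ^ p else if p = 0 then Real.log t else -(t ^ p)

/-- The modified energy density `φ_ε`: an increasing, strictly concave function on `(0,∞)`
with continuous negative second derivative that agrees with `φ` on `[3ε,∞)`, equals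
`-t^{-q}` on `(0,ε]`, and satisfies `φ_ε(t) ≥ -t^{-q}` on `(0,1)`. -/
def IsPhiEps (p ε q : ℝ) (φ : ℝ → ℝ) : Prop :=
  StrictMonoOn φ (Set.Ioi 0) ∧
  StrictConcaveOn ℝ (Set.Ioi 0) φ ∧
  (∀ t ∈ Set.Ioi (0:ℝ), DifferentiableAt ℝ φ t ∧ DifferentiableAt ℝ (deriv φ) t ∧
    deriv (deriv φ) t < 0) ∧
  ContinuousOn (deriv (deriv φ)) (Set.Ioi 0) ∧
  (∀ t : ℝ, 3 * ε ≤ t → φ t = phiFn p t) ∧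
  (∀ t : ℝ, 0 < t → t ≤ ε → φ t = -(t ^ (-q))) ∧
  (∀ t ∈ Set.Ioo (0:ℝ) 1, -(t ^ (-q)) ≤ φ t)

/-- The energy `Φ_ε(K, ξ) = ∫_{S^{n-1}} φ_ε (h_K(u) - ⟨u, ξ⟩) dμ(u)`. -/
def PhiE {n : ℕ} (μ : Measure (Eu n)) (φ : ℝ → ℝ) (K : Set (Eu n)) (ξ : Eu n) : ℝ :=
  ∫ u, φ (suppFn K u - ⟪u, ξ⟫) ∂μ


section SphereMeasure

variable {E : Type*} [NormedAddCommGroup E] [InnerProductSpace ℝ E] [FiniteDimensional ℝ E]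
  [MeasurableSpace E] [BorelSpace E]

/-- The Hausdorff measure of the orthogonal complement of a unit vector, in codimension one, is an
additive Haar measure. -/
theorem isAddHaarMeasure_hausdorffMeasure_orthogonal {d : ℕ} (hd : Module.finrank ℝ E = d + 1)
    {v : E} (hv : ‖v‖ = 1) :
    (μH[(d : ℝ)] : Measure (ℝ ∙ v)ᗮ).IsAddHaarMeasure := by
  have : Fact (Module.finrank ℝ E = d + 1) := ⟨hd⟩
  have hv0 : v ≠ 0 := by rintro rfl; simp at hv
  have h := Submodule.finrank_orthogonal_span_singleton (𝕜 := ℝ) (n := d) hv0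
  have := isAddHaarMeasure_hausdorffMeasure (E := (ℝ ∙ v)ᗮ)
  rwa [h] at this

theorem hausdorffMeasure_hemisphere_lt_top {d : ℕ} (hd : Module.finrank ℝ E = d + 1)
    {v : E} (hv : ‖v‖ = 1) :
    μH[(d : ℝ)] (sphere (0 : E) 1 ∩ {x | ⟪v, x⟫ ≤ 0}) < ⊤ := by
  have := isAddHaarMeasure_hausdorffMeasure_orthogonal hd hv
  have hg : ContDiff ℝ 1 (stereoInvFunAux v ∘ ((↑) : (ℝ ∙ v)ᗮ → E)) :=
    contDiff_stereoInvFunAux.comp (ℝ ∙ v)ᗮ.subtypeL.contDiff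
  obtain ⟨C, hC⟩ := hg.contDiffOn.exists_lipschitzOnWith (by simp)
    (convex_closedBall (0 : (ℝ ∙ v)ᗮ) 2) (isCompact_closedBall 0 2)
  refine lt_of_le_of_lt (measure_mono ?_)
    ((hC.hausdorffMeasure_image_le (d := (d : ℝ)) (by positivity)).trans_lt ?_)
  · rintro x ⟨hx, hxv⟩
    have hxv : ⟪v, x⟫ ≤ 0 := hxv
    have hx1 : ‖x‖ = 1 := by simpa using hx
    have hne : x ≠ v := by
      rintro rfl
      rw [real_inner_self_eq_norm_sq, hx1] at hxv
      norm_num at hxv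
    refine ⟨stereoToFun v x, ?_, ?_⟩
    · rw [mem_closedBall_zero_iff, stereoToFun_apply, norm_smul]
      have h1 : ‖(ℝ ∙ v)ᗮ.orthogonalProjectionOnto x‖ ≤ 1 :=
        ((ℝ ∙ v)ᗮ.norm_orthogonalProjectionOnto_apply_le x).trans hx1.le
      have h2 : ‖2 / ((1 : ℝ) - ⟪v, x⟫)‖ ≤ 2 := by
        rw [Real.norm_of_nonneg (by apply div_nonneg <;> linarith)]
        exact div_le_self (by norm_num) (by linarith)
      exact (mul_le_mul h2 h1 (norm_nonneg _) zero_le_two).trans (by norm_num)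
    · exact congrArg Subtype.val (stereo_left_inv hv (x := ⟨x, hx⟩) hne)
  · exact ENNReal.mul_lt_top (by simp) (isCompact_closedBall 0 2).measure_lt_top

theorem hausdorffMeasure_sphere_lt_top {d : ℕ} (hd : Module.finrank ℝ E = d + 1) :
    μH[(d : ℝ)] (sphere (0 : E) 1) < ⊤ := by
  have : Nontrivial E := Module.nontrivial_of_finrank_pos (R := ℝ) (by omega)
  obtain ⟨v, hv⟩ := exists_norm_eq E zero_le_one
  refine (measure_mono (t := (sphere (0 : E) 1 ∩ {x | ⟪v, x⟫ ≤ 0}) ∪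
    (sphere (0 : E) 1 ∩ {x | ⟪-v, x⟫ ≤ 0})) ?_).trans_lt
    (measure_union_lt_top (hausdorffMeasure_hemisphere_lt_top hd hv)
      (hausdorffMeasure_hemisphere_lt_top hd (by rwa [norm_neg])))
  intro x hx
  rcases le_total ⟪v, x⟫ 0 with h | h
  · exact Or.inl ⟨hx, h⟩
  · exact Or.inr ⟨hx, by simpa using h⟩

/-- Spherical caps of radius `r ≤ 1` have Hausdorff measure at least of order `r ^ d`. -/
theorem exists_le_hausdorffMeasure_cap {d : ℕ} (hd : Module.finrank ℝ E = d + 1)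
    {v : E} (hv : ‖v‖ = 1) :
    ∃ c : ℝ≥0∞, c ≠ 0 ∧ ∀ r : ℝ, 0 < r → r ≤ 1 →
      ENNReal.ofReal (r ^ d) * c ≤ μH[(d : ℝ)] (sphere (0 : E) 1 ∩ closedBall v r) := by
  have := isAddHaarMeasure_hausdorffMeasure_orthogonal hd hv
  have hfr : Module.finrank ℝ (ℝ ∙ v)ᗮ = d := by
    have : Fact (Module.finrank ℝ E = d + 1) := ⟨hd⟩
    exact Submodule.finrank_orthogonal_span_singleton (by rintro rfl; simp at hv)
  refine ⟨ENNReal.ofReal ((1 / 2) ^ d) * μH[(d : ℝ)] (ball (0 : (ℝ ∙ v)ᗮ) 1),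
    mul_ne_zero (by simp) (measure_ball_pos _ _ one_pos).ne', fun r hr hr1 => ?_⟩
  have hP : LipschitzWith 1 ((ℝ ∙ v)ᗮ.orthogonalProjectionOnto) :=
    (ℝ ∙ v)ᗮ.lipschitzWith_orthogonalProjectionOnto
  calc
    _ = μH[(d : ℝ)] (closedBall (0 : (ℝ ∙ v)ᗮ) (r / 2)) := by
      rw [Measure.addHaar_closedBall _ _ (by positivity), hfr, ← mul_assoc,
        ← ENNReal.ofReal_mul (by positivity), ← mul_pow]
      congr 4
      ring
    _ ≤ μH[(d : ℝ)] ((ℝ ∙ v)ᗮ.orthogonalProjectionOnto ''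
          (sphere (0 : E) 1 ∩ closedBall v r)) := by
      refine measure_mono fun w hw => ?_
      have hw : ‖(w : E)‖ ≤ r / 2 := by simpa using hw
      have hw0 := norm_nonneg (w : E)
      have hwv : ⟪(w : E), v⟫ = 0 := Submodule.mem_orthogonal_singleton_iff_inner_left.mp w.2
      set s : ℝ := √(1 - ‖(w : E)‖ ^ 2) with hs
      have hs2 : s ^ 2 = 1 - ‖(w : E)‖ ^ 2 := Real.sq_sqrt (by nlinarith)
      have hs0 : 0 ≤ s := Real.sqrt_nonneg _
      have hs1 : s ≤ 1 := by nlinarith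
      have key : ∀ a : ℝ, ‖(w : E) + a • v‖ ^ 2 = ‖(w : E)‖ ^ 2 + a ^ 2 := fun a => by
        rw [norm_add_sq_real, inner_smul_right, hwv, norm_smul, hv]
        simp
      refine ⟨w + s • v, ⟨?_, ?_⟩, ?_⟩
      · rw [mem_sphere_zero_iff_norm, ← sq_eq_sq₀ (norm_nonneg _) zero_le_one, key, hs2]
        ring
      · rw [mem_closedBall, dist_eq_norm, ← sq_le_sq₀ (norm_nonneg _) hr.le,
          show (w : E) + s • v - v = w + (s - 1) • v by module, key]
        nlinarith
      · rw [map_add, map_smul, Submodule.orthogonalProjectionOnto_mem_subspace_eq_self,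
          Submodule.orthogonalProjectionOnto_orthogonalComplement_singleton_eq_zero]
        simp
    _ ≤ _ := by
      simpa using hP.hausdorffMeasure_image_le (d := (d : ℝ)) (by positivity)
        (sphere (0 : E) 1 ∩ closedBall v r)

end SphereMeasure

section SupportFunction

variable {n : ℕ} {K : Set (Eu n)}

theorem bddAbove_inner_image (hK : Bornology.IsBounded K) (u : Eu n) :
    BddAbove ((fun x => ⟪x, u⟫) '' K) := by
  obtain ⟨R, hR⟩ := hK.exists_norm_le
  refine ⟨R * ‖u‖, ?_⟩
  rintro _ ⟨x, hx, rfl⟩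
  exact (real_inner_le_norm x u).trans (by gcongr; exact hR x hx)

theorem inner_le_suppFn (hK : Bornology.IsBounded K) {x : Eu n} (hx : x ∈ K) (u : Eu n) :
    ⟪x, u⟫ ≤ suppFn K u :=
  le_csSup (bddAbove_inner_image hK u) (mem_image_of_mem _ hx)

theorem suppFn_le (hne : K.Nonempty) {u : Eu n} {a : ℝ} (h : ∀ x ∈ K, ⟪x, u⟫ ≤ a) :
    suppFn K u ≤ a :=
  csSup_le (hne.image _) (by rintro _ ⟨x, hx, rfl⟩; exact h x hx)

theorem continuous_suppFn (hK : Bornology.IsBounded K) (hne : K.Nonempty) :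
    Continuous (suppFn K) := by
  obtain ⟨R, hR⟩ := hK.exists_norm_le
  refine (LipschitzWith.of_le_add_mul R.toNNReal fun u v => suppFn_le hne fun x hx => ?_).continuous
  have h1 := inner_le_suppFn hK hx v
  have h2 : ⟪x, u - v⟫ ≤ R.toNNReal * dist u v := by
    rw [dist_eq_norm]
    exact (real_inner_le_norm x _).trans (by gcongr; exact (hR x hx).trans (Real.le_coe_toNNReal R))
  rw [inner_sub_right] at h2
  linarith

theorem continuous_suppFn_sub_inner (hK : Bornology.IsBounded K) (hne : K.Nonempty) (ξ : Eu n) :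
    Continuous fun u => suppFn K u - ⟪u, ξ⟫ :=
  (continuous_suppFn hK hne).sub (continuous_id.inner continuous_const)

theorem le_suppFn_sub_inner_of_closedBall_subset (hK : Bornology.IsBounded K) {ξ : Eu n} {r : ℝ}
    (hr : 0 ≤ r) (hball : closedBall ξ r ⊆ K) {u : Eu n} (hu : ‖u‖ = 1) :
    r ≤ suppFn K u - ⟪u, ξ⟫ := by
  have h := inner_le_suppFn hK (x := ξ + r • u)
    (hball (by simp [norm_smul, hu, abs_of_nonneg hr])) u
  rw [inner_add_left, inner_smul_left, real_inner_self_eq_norm_sq, hu, real_inner_comm] at h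
  simp at h
  linarith

theorem exists_le_suppFn_sub_inner (hK : Bornology.IsBounded K) {ξ : Eu n} (hξ : ξ ∈ interior K) :
    ∃ r > 0, ∀ u : Eu n, ‖u‖ = 1 → r ≤ suppFn K u - ⟪u, ξ⟫ := by
  obtain ⟨r, hr, hball⟩ := nhds_basis_closedBall.mem_iff.mp (mem_interior_iff_mem_nhds.mp hξ)
  exact ⟨r, hr, fun u hu => le_suppFn_sub_inner_of_closedBall_subset hK hr.le hball hu⟩

theorem exists_suppFn_sub_inner_le (hK : Bornology.IsBounded K) (hne : K.Nonempty) :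
    ∃ D > 0, ∀ ξ ∈ K, ∀ u : Eu n, ‖u‖ = 1 → suppFn K u - ⟪u, ξ⟫ ≤ D := by
  obtain ⟨R, hR0, hR⟩ := hK.exists_pos_norm_le
  refine ⟨R + R, by positivity, fun ξ hξ u hu => ?_⟩
  have h1 : suppFn K u ≤ R := suppFn_le hne fun x hx =>
    (real_inner_le_norm x u).trans (by rw [hu, mul_one]; exact hR x hx)
  have h2 : -⟪u, ξ⟫ ≤ R := by
    rw [← inner_neg_right]
    exact (real_inner_le_norm u _).trans (by rw [hu, one_mul, norm_neg]; exact hR ξ hξ)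
  linarith

/-- At a boundary point of a convex body the gap `h_K(u) - ⟪u, ξ⟫` vanishes linearly near an outer
normal direction. -/
theorem exists_suppFn_sub_inner_le_dist (hK : IsConvexBody K) {ξ : Eu n} (hξ : ξ ∈ K)
    (hξi : ξ ∉ interior K) :
    ∃ v : Eu n, ‖v‖ = 1 ∧ ∃ C > 0, ∀ u : Eu n, suppFn K u - ⟪u, ξ⟫ ≤ C * dist u v := by
  obtain ⟨hconv, hcpt, hint⟩ := hK
  obtain ⟨ℓ, hℓ⟩ := geometric_hahn_banach_open_point hconv.interior isOpen_interior hξi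
  have hle : ∀ x ∈ K, ℓ x ≤ ℓ ξ := fun x hx => by
    have hx' : x ∈ closure (interior K) := by
      rw [hconv.closure_interior_eq_closure_of_nonempty_interior hint]
      exact subset_closure hx
    exact closure_minimal (fun y hy => (hℓ y hy).le)
      (isClosed_le ℓ.continuous continuous_const) hx'
  set w := (InnerProductSpace.toDual ℝ (Eu n)).symm ℓ with hw
  have hwℓ : ∀ x, ⟪w, x⟫ = ℓ x := fun x => InnerProductSpace.toDual_symm_apply
  have hw0 : w ≠ 0 := by
    rintro h0
    obtain ⟨y, hy⟩ := hint
    have := hℓ y hy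
    rw [← hwℓ, ← hwℓ, h0] at this
    simp at this
  have hwn : 0 < ‖w‖ := norm_pos_iff.mpr hw0
  obtain ⟨R, hR0, hR⟩ := hcpt.isBounded.exists_pos_norm_le
  refine ⟨‖w‖⁻¹ • w, norm_smul_inv_norm hw0, R + R, by positivity, fun u => ?_⟩
  set v := ‖w‖⁻¹ • w with hv
  rw [sub_le_iff_le_add]
  refine suppFn_le ⟨ξ, hξ⟩ fun x hx => ?_
  have h1 : ⟪x - ξ, v⟫ ≤ 0 := by
    rw [hv, inner_smul_right, real_inner_comm, inner_sub_right, hwℓ, hwℓ]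
    exact mul_nonpos_of_nonneg_of_nonpos (by positivity) (sub_nonpos.mpr (hle x hx))
  have h2 : ⟪x - ξ, u - v⟫ ≤ (R + R) * dist u v := by
    rw [dist_eq_norm]
    refine (real_inner_le_norm _ _).trans ?_
    gcongr
    exact (norm_sub_le _ _).trans (add_le_add (hR x hx) (hR ξ hξ))
  rw [inner_sub_right, inner_sub_left x ξ u, real_inner_comm u ξ] at h2
  linarith

end SupportFunction

section Barrier

open scoped Topology

variable {φ : ℝ → ℝ} {M : ℝ}

/-- The deficit `M - φ(t)`, extended by `∞` to `t ≤ 0`. -/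
def barrier (φ : ℝ → ℝ) (M t : ℝ) : ℝ≥0∞ :=
  if 0 < t then ENNReal.ofReal (M - φ t) else ⊤

theorem barrier_of_pos {t : ℝ} (ht : 0 < t) : barrier φ M t = ENNReal.ofReal (M - φ t) :=
  if_pos ht

theorem barrier_of_nonpos {t : ℝ} (ht : t ≤ 0) : barrier φ M t = ⊤ :=
  if_neg ht.not_gt

theorem antitone_barrier (hmono : MonotoneOn φ (Ioi 0)) : Antitone (barrier φ M) := by
  intro s t hst
  rcases le_or_gt s 0 with hs | hs
  · simp [barrier_of_nonpos hs]
  · rw [barrier_of_pos hs, barrier_of_pos (hs.trans_le hst)]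
    exact ENNReal.ofReal_le_ofReal (sub_le_sub_left (hmono hs (hs.trans_le hst) hst) M)

theorem lowerSemicontinuous_barrier (hmono : MonotoneOn φ (Ioi 0)) (hcont : ContinuousOn φ (Ioi 0))
    (hlim : Tendsto φ (𝓝[>] 0) atBot) : LowerSemicontinuous (barrier φ M) := by
  intro t y hy
  rcases lt_or_ge 0 t with ht | ht
  · have hc : ContinuousAt (fun s => ENNReal.ofReal (M - φ s)) t :=
      ENNReal.continuous_ofReal.continuousAt.comp
        (continuousAt_const.sub (hcont.continuousAt (Ioi_mem_nhds ht)))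
    rw [barrier_of_pos ht] at hy
    filter_upwards [hc.eventually_const_lt hy, Ioi_mem_nhds ht] with s hs hs0
    rwa [barrier_of_pos hs0]
  · rw [barrier_of_nonpos ht] at hy
    obtain ⟨δ, hδ, hδ0⟩ := ((hlim.eventually_lt_atBot (M - y.toReal)).and
      self_mem_nhdsWithin).exists
    have hyδ : y < barrier φ M δ := by
      rw [barrier_of_pos hδ0, ← ENNReal.ofReal_toReal hy.ne]
      exact (ENNReal.ofReal_lt_ofReal_iff_of_nonneg ENNReal.toReal_nonneg).mpr (by linarith)
    filter_upwards [Iio_mem_nhds (ht.trans_lt hδ0)] with s hs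
    exact hyδ.trans_le (antitone_barrier hmono (le_of_lt hs))

end Barrier

section PhiEps

open scoped Topology

variable {p ε q : ℝ} {φ : ℝ → ℝ}

theorem IsPhiEps.continuousOn (hφ : IsPhiEps p ε q φ) : ContinuousOn φ (Ioi 0) :=
  fun t ht => (hφ.2.2.1 t ht).1.continuousAt.continuousWithinAt

theorem IsPhiEps.eq_neg_rpow (hφ : IsPhiEps p ε q φ) {t : ℝ} (ht : 0 < t) (hte : t ≤ ε) :
    φ t = -(t ^ (-q)) :=
  hφ.2.2.2.2.2.1 t ht hte

theorem IsPhiEps.exponent_ne_zero (hφ : IsPhiEps p ε q φ) (hε : 0 < ε) : q ≠ 0 := by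
  rintro rfl
  have h := hφ.1 (mem_Ioi.mpr (half_pos hε)) (mem_Ioi.mpr hε) (half_lt_self hε)
  rw [hφ.eq_neg_rpow (half_pos hε) (half_le_self hε.le), hφ.eq_neg_rpow hε le_rfl] at h
  simp at h

theorem IsPhiEps.tendsto_atBot (hφ : IsPhiEps p ε q φ) (hε : 0 < ε) (hq : 0 < q) :
    Tendsto φ (𝓝[>] 0) atBot := by
  refine (tendsto_neg_atTop_atBot.comp (tendsto_rpow_neg_nhdsGT_zero (neg_neg_of_pos hq))).congr' ?_
  filter_upwards [Ioc_mem_nhdsGT hε] with t ht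
  exact (hφ.eq_neg_rpow ht.1 ht.2).symm

end PhiEps

section Energy

open scoped Topology

variable {n : ℕ} {μ : Measure (Eu n)} {K : Set (Eu n)} {p ε q : ℝ} {φ : ℝ → ℝ} {M : ℝ}

/-- The energy `∫ (M - φ(h_K(u) - ⟪u, ξ⟫)) dμ(u)`, extended by `∞` where the gap vanishes. -/
def barrierEnergy (μ : Measure (Eu n)) (φ : ℝ → ℝ) (M : ℝ) (K : Set (Eu n)) (ξ : Eu n) : ℝ≥0∞ :=
  ∫⁻ u, barrier φ M (suppFn K u - ⟪u, ξ⟫) ∂μ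

theorem measurable_barrier_suppFn (hmono : MonotoneOn φ (Ioi 0)) (hK : Bornology.IsBounded K)
    (hne : K.Nonempty) (ξ : Eu n) :
    Measurable fun u => barrier φ M (suppFn K u - ⟪u, ξ⟫) :=
  (antitone_barrier hmono).measurable.comp (continuous_suppFn_sub_inner hK hne ξ).measurable

theorem lowerSemicontinuous_barrierEnergy (hmono : MonotoneOn φ (Ioi 0))
    (hcont : ContinuousOn φ (Ioi 0)) (hlim : Tendsto φ (𝓝[>] 0) atBot)
    (hK : Bornology.IsBounded K) (hne : K.Nonempty) :
    LowerSemicontinuous (barrierEnergy μ φ M K) := by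
  refine lowerSemicontinuous_iff_le_liminf.mpr fun ξ => le_trans (lintegral_mono fun u => ?_)
    (lintegral_liminf_le fun η => measurable_barrier_suppFn hmono hK hne η)
  have hu : Continuous fun η : Eu n => suppFn K u - ⟪u, η⟫ :=
    continuous_const.sub (continuous_const.inner continuous_id)
  exact ((lowerSemicontinuous_barrier hmono hcont hlim).comp hu).le_liminf ξ

theorem barrierEnergy_eq_top {d : ℕ} (hφ : IsPhiEps p ε q φ) (hε : 0 < ε) (hq : d ≤ q)
    (hM : 0 ≤ M) (hcap : ∀ v : Eu n, ‖v‖ = 1 → ∃ c : ℝ≥0∞, c ≠ 0 ∧ ∀ r : ℝ, 0 < r → r ≤ 1 →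
      ENNReal.ofReal (r ^ d) * c ≤ μ (closedBall v r))
    (hK : IsConvexBody K) {ξ : Eu n} (hξ : ξ ∈ K) (hξi : ξ ∉ interior K) :
    barrierEnergy μ φ M K ξ = ⊤ := by
  by_contra hfin
  obtain ⟨v, hv, C, hC, hgap⟩ := exists_suppFn_sub_inner_le_dist hK hξ hξi
  obtain ⟨c, hc, hcv⟩ := hcap v hv
  set G : Eu n → ℝ≥0∞ := fun u => barrier φ M (suppFn K u - ⟪u, ξ⟫) with hG
  have hanti : Antitone (barrier φ M) := antitone_barrier hφ.1.monotoneOn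
  have hGm : Measurable G :=
    measurable_barrier_suppFn hφ.1.monotoneOn hK.2.1.isBounded ⟨ξ, hξ⟩ ξ
  have hfinν : IsFiniteMeasure (μ.withDensity G) := isFiniteMeasure_withDensity hfin
  have hGv : G v = ⊤ := barrier_of_nonpos (by simpa using hgap v)
  have hμv : μ {v} = 0 := measure_mono_null (by simpa using hGv) (ae_lt_top hGm hfin)
  have hνv : μ.withDensity G {v} = 0 := withDensity_absolutelyContinuous _ _ hμv
  have hlim : Tendsto (fun r => μ.withDensity G (closedBall v r)) (𝓝[>] 0) (𝓝 0) := by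
    have h := tendsto_measure_biInter_gt (μ := μ.withDensity G) (s := closedBall v) (a := (0 : ℝ))
      (fun r _ => measurableSet_closedBall.nullMeasurableSet)
      (fun i j _ hij => closedBall_subset_closedBall hij) ⟨1, one_pos, measure_ne_top _ _⟩
    have hinter : ⋂ r > (0 : ℝ), closedBall v r = {v} := by
      ext x
      simp only [mem_iInter, mem_closedBall, mem_singleton_iff]
      exact ⟨fun hx => dist_le_zero.mp (le_of_forall_pos_le_add fun r hr => by simpa using hx r hr),
        fun hx r hr => by simpa [hx] using le_of_lt hr⟩
    rwa [hinter, hνv] at h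
  have hlow : ∀ᶠ r in 𝓝[>] (0 : ℝ),
      ENNReal.ofReal (C ^ (-q)) * c ≤ μ.withDensity G (closedBall v r) := by
    filter_upwards [Ioc_mem_nhdsGT one_pos, Ioc_mem_nhdsGT (div_pos hε hC)] with r hr hrε
    have hCr : C * r ≤ ε := by
      have := (le_div_iff₀ hC).mp hrε.2
      linarith
    have hCr0 : 0 < C * r := mul_pos hC hr.1
    calc
      _ ≤ ENNReal.ofReal ((C * r) ^ (-q)) * (ENNReal.ofReal (r ^ d) * c) := by
        rw [← mul_assoc, ← ENNReal.ofReal_mul (by positivity), Real.mul_rpow hC.le hr.1.le]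
        gcongr
        rw [mul_assoc, ← Real.rpow_natCast r d, ← Real.rpow_add hr.1]
        exact le_mul_of_one_le_right (by positivity)
          (Real.one_le_rpow_of_pos_of_le_one_of_nonpos hr.1 hr.2 (by linarith))
      _ ≤ barrier φ M (C * r) * μ (closedBall v r) := by
        gcongr
        · rw [barrier_of_pos hCr0, hφ.eq_neg_rpow hCr0 hCr]
          exact ENNReal.ofReal_le_ofReal (by linarith)
        · exact hcv r hr.1 hr.2
      _ = ∫⁻ _ in closedBall v r, barrier φ M (C * r) ∂μ := (setLIntegral_const _ _).symm
      _ ≤ ∫⁻ u in closedBall v r, G u ∂μ :=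
        setLIntegral_mono hGm fun u hu => hanti ((hgap u).trans
          (mul_le_mul_of_nonneg_left hu hC.le))
      _ = _ := (withDensity_apply _ measurableSet_closedBall).symm
  have hzero := ge_of_tendsto hlim hlow
  refine mul_ne_zero ?_ hc (le_antisymm hzero zero_le)
  exact (ENNReal.ofReal_pos.mpr (by positivity)).ne'

theorem integrable_comp_suppFn [IsFiniteMeasure μ] (hμ : ∀ᵐ u ∂μ, ‖u‖ = 1)
    (hmono : MonotoneOn φ (Ioi 0)) (hcont : ContinuousOn φ (Ioi 0))
    (hK : Bornology.IsBounded K) {ξ : Eu n} (hξ : ξ ∈ interior K) :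
    Integrable (fun u => φ (suppFn K u - ⟪u, ξ⟫)) μ := by
  have hξK := interior_subset hξ
  obtain ⟨r, hr, hlow⟩ := exists_le_suppFn_sub_inner hK hξ
  obtain ⟨D, hD, hup⟩ := exists_suppFn_sub_inner_le hK ⟨ξ, hξK⟩
  have hc : Continuous fun u => φ (max r (suppFn K u - ⟪u, ξ⟫)) :=
    hcont.comp_continuous (continuous_const.max (continuous_suppFn_sub_inner hK ⟨ξ, hξK⟩ ξ))
      fun u => lt_max_of_lt_left hr
  refine Integrable.of_bound (hc.aestronglyMeasurable.congr ?_) (max |φ r| |φ D|) ?_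
  · filter_upwards [hμ] with u hu
    rw [max_eq_right (hlow u hu)]
  · filter_upwards [hμ] with u hu
    have h0 : 0 < suppFn K u - ⟪u, ξ⟫ := hr.trans_le (hlow u hu)
    exact abs_le_max_abs_abs (hmono hr h0 (hlow u hu)) (hmono h0 hD (hup ξ hξK u hu))

theorem barrierEnergy_eq_ofReal [IsFiniteMeasure μ] (hμ : ∀ᵐ u ∂μ, ‖u‖ = 1)
    (hmono : MonotoneOn φ (Ioi 0)) (hcont : ContinuousOn φ (Ioi 0))
    (hK : Bornology.IsBounded K) {ξ : Eu n} (hξ : ξ ∈ interior K)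
    (hM : ∀ u : Eu n, ‖u‖ = 1 → φ (suppFn K u - ⟪u, ξ⟫) ≤ M) :
    0 ≤ M * μ.real univ - PhiE μ φ K ξ ∧
      barrierEnergy μ φ M K ξ = ENNReal.ofReal (M * μ.real univ - PhiE μ φ K ξ) := by
  have hint := integrable_comp_suppFn hμ hmono hcont hK hξ
  have hnonneg : 0 ≤ᵐ[μ] fun u => M - φ (suppFn K u - ⟪u, ξ⟫) := by
    filter_upwards [hμ] with u hu
    exact sub_nonneg.mpr (hM u hu)
  have heq : ∫ u, (M - φ (suppFn K u - ⟪u, ξ⟫)) ∂μ = M * μ.real univ - PhiE μ φ K ξ := by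
    rw [integral_sub (integrable_const _) hint, integral_const, smul_eq_mul, mul_comm]
    rfl
  rw [← heq]
  refine ⟨integral_nonneg_of_ae hnonneg, ?_⟩
  refine Eq.trans (lintegral_congr_ae ?_)
    (ofReal_integral_eq_lintegral_ofReal ((integrable_const M).sub hint) hnonneg).symm
  obtain ⟨r, hr, hlow⟩ := exists_le_suppFn_sub_inner hK hξ
  filter_upwards [hμ] with u hu
  exact barrier_of_pos (hr.trans_le (hlow u hu))

theorem exists_isMaxOn_PhiE [IsFiniteMeasure μ] (hμ : ∀ᵐ u ∂μ, ‖u‖ = 1) {d : ℕ}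
    (hφ : IsPhiEps p ε q φ) (hε : 0 < ε) (hdq : d ≤ q) (hq : 0 < q)
    (hcap : ∀ v : Eu n, ‖v‖ = 1 → ∃ c : ℝ≥0∞, c ≠ 0 ∧ ∀ r : ℝ, 0 < r → r ≤ 1 →
      ENNReal.ofReal (r ^ d) * c ≤ μ (closedBall v r)) (hK : IsConvexBody K) :
    ∃ ξ ∈ interior K, ∀ η ∈ interior K, PhiE μ φ K η ≤ PhiE μ φ K ξ := by
  have hmono := hφ.1.monotoneOn
  have hb := hK.2.1.isBounded
  obtain ⟨ζ, hζ⟩ := hK.2.2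
  have hne : K.Nonempty := ⟨ζ, interior_subset hζ⟩
  obtain ⟨D, hD, hup⟩ := exists_suppFn_sub_inner_le hb hne
  have henergy : ∀ η ∈ interior K, 0 ≤ |φ D| * μ.real univ - PhiE μ φ K η ∧
      barrierEnergy μ φ |φ D| K η = ENNReal.ofReal (|φ D| * μ.real univ - PhiE μ φ K η) := by
    intro η hη
    refine barrierEnergy_eq_ofReal hμ hmono hφ.continuousOn hb hη fun u hu => ?_
    obtain ⟨r, hr, hlow⟩ := exists_le_suppFn_sub_inner hb hη
    exact (hmono (hr.trans_le (hlow u hu)) hD (hup η (interior_subset hη) u hu)).trans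
      (le_abs_self _)
  obtain ⟨ξ, hξK, hmin⟩ := ((lowerSemicontinuous_barrierEnergy (μ := μ) (M := |φ D|) hmono
    hφ.continuousOn (hφ.tendsto_atBot hε hq) hb hne).lowerSemicontinuousOn K).exists_isMinOn
    hne hK.2.1
  have hξ : ξ ∈ interior K := by
    by_contra hξi
    have h : barrierEnergy μ φ |φ D| K ξ ≤ _ := hmin (interior_subset hζ)
    rw [barrierEnergy_eq_top hφ hε hdq (abs_nonneg _) hcap hK hξK hξi,
      (henergy ζ hζ).2] at h
    exact ENNReal.ofReal_ne_top (top_le_iff.mp h)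
  refine ⟨ξ, hξ, fun η hη => ?_⟩
  have h : barrierEnergy μ φ |φ D| K ξ ≤ _ := hmin (interior_subset hη)
  rw [(henergy ξ hξ).2, (henergy η hη).2,
    ENNReal.ofReal_le_ofReal_iff (henergy η hη).1] at h
  linarith

theorem PhiE_maximizer_unique [IsFiniteMeasure μ] (hμ : ∀ᵐ u ∂μ, ‖u‖ = 1)
    (hconc : StrictConcaveOn ℝ (Ioi 0) φ) (hmono : MonotoneOn φ (Ioi 0))
    (hcont : ContinuousOn φ (Ioi 0)) (hpos : ∀ v : Eu n, ‖v‖ = 1 → 0 < μ (closedBall v 1))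
    (hconv : Convex ℝ K) (hK : Bornology.IsBounded K) {ξ₁ ξ₂ : Eu n}
    (h₁ : ξ₁ ∈ interior K) (hmax₁ : ∀ η ∈ interior K, PhiE μ φ K η ≤ PhiE μ φ K ξ₁)
    (h₂ : ξ₂ ∈ interior K) (hmax₂ : ∀ η ∈ interior K, PhiE μ φ K η ≤ PhiE μ φ K ξ₂) :
    ξ₁ = ξ₂ := by
  by_contra hne
  set m : Eu n := (1 / 2 : ℝ) • ξ₁ + (1 / 2 : ℝ) • ξ₂ with hm
  have hmK : m ∈ interior K :=
    hconv.interior h₁ h₂ (by norm_num) (by norm_num) (by norm_num)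
  have hI₁ := integrable_comp_suppFn hμ hmono hcont hK h₁
  have hI₂ := integrable_comp_suppFn hμ hmono hcont hK h₂
  have hIm := integrable_comp_suppFn hμ hmono hcont hK hmK
  set g : Eu n → ℝ := fun u => φ (suppFn K u - ⟪u, m⟫) -
    ((1 / 2 : ℝ) * φ (suppFn K u - ⟪u, ξ₁⟫) + (1 / 2 : ℝ) * φ (suppFn K u - ⟪u, ξ₂⟫)) with hg
  obtain ⟨r₁, hr₁, hlow₁⟩ := exists_le_suppFn_sub_inner hK h₁
  obtain ⟨r₂, hr₂, hlow₂⟩ := exists_le_suppFn_sub_inner hK h₂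
  have hmid : ∀ u : Eu n, suppFn K u - ⟪u, m⟫ =
      (1 / 2 : ℝ) • (suppFn K u - ⟪u, ξ₁⟫) + (1 / 2 : ℝ) • (suppFn K u - ⟪u, ξ₂⟫) := fun u => by
    rw [hm, inner_add_right, inner_smul_right, inner_smul_right, smul_eq_mul, smul_eq_mul]
    ring
  have hg0 : 0 ≤ᵐ[μ] g := by
    filter_upwards [hμ] with u hu
    have := hconc.concaveOn.2 (hr₁.trans_le (hlow₁ u hu)) (hr₂.trans_le (hlow₂ u hu))
      (one_half_pos (α := ℝ)).le (one_half_pos (α := ℝ)).le (by norm_num)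
    rw [← hmid] at this
    exact sub_nonneg.mpr this
  have hI₁₂ : Integrable (fun u => (1 / 2 : ℝ) * φ (suppFn K u - ⟪u, ξ₁⟫) +
      (1 / 2 : ℝ) * φ (suppFn K u - ⟪u, ξ₂⟫)) μ := (hI₁.const_mul _).add (hI₂.const_mul _)
  have hgint : Integrable g μ := hIm.sub hI₁₂
  have hgle : ∫ u, g u ∂μ ≤ 0 := by
    have heq : ∫ u, g u ∂μ =
        PhiE μ φ K m - ((1 / 2) * PhiE μ φ K ξ₁ + (1 / 2) * PhiE μ φ K ξ₂) := by
      rw [hg, integral_sub hIm hI₁₂,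
        integral_add (hI₁.const_mul _) (hI₂.const_mul _), integral_const_mul, integral_const_mul]
      rfl
    have := hmax₁ m hmK
    have := hmax₂ m hmK
    linarith
  have hgz : g =ᵐ[μ] 0 :=
    (integral_eq_zero_iff_of_nonneg_ae hg0 hgint).mp (hgle.antisymm (integral_nonneg_of_ae hg0))
  set v : Eu n := ‖ξ₁ - ξ₂‖⁻¹ • (ξ₁ - ξ₂) with hv
  have hv1 : ‖v‖ = 1 := norm_smul_inv_norm (sub_ne_zero.mpr hne)
  refine (hpos v hv1).ne' (measure_mono_null (t := {u | ¬ (‖u‖ = 1 ∧ g u = 0)}) ?_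
    (hμ.and hgz))
  rintro u hu ⟨hu1, hgu⟩
  have hinner : ⟪u, ξ₁ - ξ₂⟫ ≠ 0 := by
    intro h0
    have huv : ⟪u, v⟫ = 0 := by rw [hv, inner_smul_right, h0, mul_zero]
    have hdist : ‖u - v‖ ≤ 1 := by rwa [← dist_eq_norm]
    have hsq := norm_sub_sq_real u v
    rw [huv, hu1, hv1] at hsq
    nlinarith [norm_nonneg (u - v)]
  have hne' : suppFn K u - ⟪u, ξ₁⟫ ≠ suppFn K u - ⟪u, ξ₂⟫ := fun h => hinner (by
    rw [inner_sub_right]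
    linarith)
  have hlt := hconc.2 (hr₁.trans_le (hlow₁ u hu1)) (hr₂.trans_le (hlow₂ u hu1)) hne'
    (one_half_pos (α := ℝ)) (one_half_pos (α := ℝ)) (by norm_num)
  rw [← hmid] at hlt
  exact (sub_pos.mpr hlt).ne' hgu

end Energy

/-- Proposition 3.2: for every convex body `K` there is a unique
`ξ(K) ∈ int K` maximizing `ξ ↦ Φ_ε(K, ξ)` over `int K`. -/
theorem exists_unique_optimal_center
    (n : ℕ) (p ε q τ₁ τ₂ : ℝ)
    (hp : -(n : ℝ) < p ∧ p < 1) (hε : ε ∈ Set.Ioo (0:ℝ) (1/3))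
    (hq : q = max |p| ((n : ℝ) - 1))
    (φ : ℝ → ℝ) (hφ : IsPhiEps p ε q φ)
    (hτ : 0 < τ₁ ∧ τ₁ < τ₂)
    (f : Eu n → ℝ) (hf : ∀ u ∈ sphere (0 : Eu n) 1, τ₁ < f u ∧ f u < τ₂)
    (μ : Measure (Eu n))
    (hμ : μ = ((μH[(n:ℝ) - 1]).restrict (sphere (0 : Eu n) 1)).withDensity
      (fun u => ENNReal.ofReal (f u)))
    (K : Set (Eu n)) (hK : IsConvexBody K) :
    ∃! ξ : Eu n, ξ ∈ interior K ∧
      ∀ η ∈ interior K, PhiE μ φ K η ≤ PhiE μ φ K ξ := by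
  obtain ⟨hε0, hε1⟩ := hε
  rcases n with _ | d
  · have hint : interior K = univ := Subsingleton.eq_univ_of_nonempty hK.2.2
    exact ⟨0, ⟨by simp [hint], fun η _ => (congrArg _ (Subsingleton.elim η 0)).le⟩,
      fun η _ => Subsingleton.elim η 0⟩
  have hd : Module.finrank ℝ (Eu (d + 1)) = d + 1 := finrank_euclideanSpace_fin
  have hdim : ((d + 1 : ℕ) : ℝ) - 1 = d := by push_cast; ring
  rw [hdim] at hμ hq
  have hdq : (d : ℝ) ≤ q := hq ▸ le_max_right _ _
  have hq0 : 0 < q :=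
    lt_of_le_of_ne (hq ▸ (abs_nonneg p).trans (le_max_left _ _)) (hφ.exponent_ne_zero hε0).symm
  have hupper : μ ≤ ENNReal.ofReal τ₂ • (μH[(d : ℝ)]).restrict (sphere (0 : Eu (d + 1)) 1) := by
    rw [hμ, ← withDensity_const]
    refine withDensity_mono ?_
    filter_upwards [ae_restrict_mem isClosed_sphere.measurableSet] with u hu
    exact ENNReal.ofReal_le_ofReal (hf u hu).2.le
  have hlower : ENNReal.ofReal τ₁ • (μH[(d : ℝ)]).restrict (sphere (0 : Eu (d + 1)) 1) ≤ μ := by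
    rw [hμ, ← withDensity_const]
    refine withDensity_mono ?_
    filter_upwards [ae_restrict_mem isClosed_sphere.measurableSet] with u hu
    exact ENNReal.ofReal_le_ofReal (hf u hu).1.le
  have hfin : IsFiniteMeasure μ := ⟨(hupper univ).trans_lt (by
    simpa using ENNReal.mul_lt_top ENNReal.ofReal_lt_top (hausdorffMeasure_sphere_lt_top hd))⟩
  have hsphere : ∀ᵐ u ∂μ, ‖u‖ = 1 := by
    rw [hμ]
    refine (withDensity_absolutelyContinuous _ _).ae_le ?_
    filter_upwards [ae_restrict_mem isClosed_sphere.measurableSet] with u hu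
    simpa using hu
  have hcap : ∀ v : Eu (d + 1), ‖v‖ = 1 → ∃ c : ℝ≥0∞, c ≠ 0 ∧ ∀ r : ℝ, 0 < r → r ≤ 1 →
      ENNReal.ofReal (r ^ d) * c ≤ μ (closedBall v r) := by
    intro v hv
    obtain ⟨c, hc, hcv⟩ := exists_le_hausdorffMeasure_cap hd hv
    refine ⟨ENNReal.ofReal τ₁ * c, mul_ne_zero (ENNReal.ofReal_pos.mpr hτ.1).ne' hc,
      fun r hr hr1 => le_trans ?_ (hlower (closedBall v r))⟩
    rw [Measure.smul_apply, smul_eq_mul, Measure.restrict_apply measurableSet_closedBall,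
      inter_comm, mul_left_comm]
    gcongr
    exact hcv r hr hr1
  obtain ⟨ξ, hξ, hmax⟩ := exists_isMaxOn_PhiE hsphere hφ hε0 hdq hq0 hcap hK
  refine ⟨ξ, ⟨hξ, hmax⟩, fun η hη => ?_⟩
  refine PhiE_maximizer_unique hsphere hφ.2.1 hφ.1.monotoneOn hφ.continuousOn (fun v hv => ?_)
    hK.1 hK.2.1.isBounded hη.1 hη.2 hξ hmax
  obtain ⟨c, hc, hcv⟩ := hcap v hv
  refine (pos_iff_ne_zero.mpr hc).trans_le ?_
  simpa using hcv 1 one_pos le_rfl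

end
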